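/- Let p be a prime different from 7. Then the Diophantine equation x^4 + y^4 = z^p has no solutions in the First Case; that is, for all integers x, y, z with gcd(x, y) = 1 and x^4 + y^4 = z^p, one has p ∣ x·y. -/

import Mathlib

open Finset NumberTheorySymbols

/-- real and imaginary parts (the latter divided by `b`) of `(a+bi)^n`. -/
def luc (a b : ℤ) : ℕ → ℤ × ℤ
  | 0 => (1, 0)
  | n + 1 => (a * (luc a b n).1 - b ^ 2 * (luc a b n).2, (luc a b n).1 + a * (luc a b n).2)

def lR (a b : ℤ) (n : ℕ) : ℤ := (luc a b n).1
def lU (a b : ℤ) (n : ℕ) : ℤ := (luc a b n).2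

lemma lR_zero (a b : ℤ) : lR a b 0 = 1 := rfl
lemma lU_zero (a b : ℤ) : lU a b 0 = 0 := rfl
lemma lR_succ (a b : ℤ) (n : ℕ) : lR a b (n + 1) = a * lR a b n - b ^ 2 * lU a b n := rfl
lemma lU_succ (a b : ℤ) (n : ℕ) : lU a b (n + 1) = lR a b n + a * lU a b n := rfl
lemma lU_one (a b : ℤ) : lU a b 1 = 1 := by simp [lU_succ, lR_zero, lU_zero]

lemma luc_add (a b : ℤ) (m n : ℕ) :
    lR a b (m + n) = lR a b m * lR a b n - b ^ 2 * lU a b m * lU a b n ∧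
    lU a b (m + n) = lU a b m * lR a b n + lR a b m * lU a b n := by
  induction n with
  | zero => simp [lR_zero, lU_zero]
  | succ n ih =>
    obtain ⟨h1, h2⟩ := ih
    rw [← add_assoc, lR_succ a b (m + n), lU_succ a b (m + n), lR_succ a b n, lU_succ a b n, h1, h2]
    constructor <;> ring

lemma luc_norm (a b : ℤ) (n : ℕ) :
    lR a b n ^ 2 + b ^ 2 * lU a b n ^ 2 = (a ^ 2 + b ^ 2) ^ n := by
  induction n with
  | zero => simp [lR_zero, lU_zero]
  | succ n ih => rw [lR_succ, lU_succ, pow_succ (a ^ 2 + b ^ 2) n, ← ih]; ring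

lemma luc_gauss (a b : ℤ) (n : ℕ) :
    ((⟨a, b⟩ : GaussianInt) ^ n) = ⟨lR a b n, b * lU a b n⟩ := by
  induction n with
  | zero => simp [lR_zero, lU_zero]; rfl
  | succ n ih =>
    rw [pow_succ, ih, lR_succ, lU_succ]
    ext <;> simp <;> ring

lemma lU_dvd1 (a b : ℤ) (r m : ℕ) :
    lU a b m ∣ lU a b (r + 2 * m) - (a ^ 2 + b ^ 2) ^ m * lU a b r := by
  rw [(luc_add a b r (2 * m)).2, two_mul, (luc_add a b m m).1, (luc_add a b m m).2,
    ← luc_norm a b m]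
  exact ⟨-2 * b ^ 2 * lU a b m * lU a b r + 2 * lR a b r * lR a b m, by ring⟩

lemma lU_dvd2 (a b : ℤ) (n n' m : ℕ) (h : n + n' = 2 * m) :
    lU a b m ∣ (a ^ 2 + b ^ 2) ^ n * lU a b n' - (-1) * ((a ^ 2 + b ^ 2) ^ m * lU a b n) := by
  have h1 := luc_add a b n' n
  have h2 := luc_add a b m m
  rw [add_comm n' n, h, two_mul] at h1
  have e1 := h1.1.symm.trans h2.1
  have e2 := h1.2.symm.trans h2.2
  rw [← luc_norm a b m, ← luc_norm a b n]
  refine ⟨2 * lR a b m * lR a b n + 2 * b ^ 2 * lU a b m * lU a b n, ?_⟩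
  linear_combination lR a b n * e2 - lU a b n * e1

lemma lU_modQ (a b : ℤ) (n : ℕ) :
    (a ^ 2 + b ^ 2) ∣ lU a b (n + 1) - (2 * a) ^ n ∧
    (a ^ 2 + b ^ 2) ∣ lR a b (n + 1) + a * lU a b (n + 1) - (2 * a) ^ (n + 1) := by
  induction n with
  | zero => simp [lU_succ, lR_succ, lR_zero, lU_zero]; exact ⟨0, by ring⟩
  | succ n ih =>
    obtain ⟨⟨c, hc⟩, ⟨d, hd⟩⟩ := ih
    refine ⟨⟨d, by rw [lU_succ]; exact hd⟩, ?_⟩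
    rw [lU_succ a b (n+1), lR_succ a b (n+1)]
    refine ⟨2 * a * d - lU a b (n + 1), ?_⟩
    rw [pow_succ]
    linear_combination 2 * a * hd

lemma lU_modb (a b : ℤ) (n : ℕ) :
    b ∣ lR a b n - a ^ n ∧ b ∣ lU a b (n + 1) - (n + 1) * a ^ n := by
  induction n with
  | zero => simp [lU_succ, lR_zero, lU_zero]
  | succ n ih =>
    obtain ⟨⟨c, hc⟩, ⟨d, hd⟩⟩ := ih
    have h1 : lR a b (n + 1) - a ^ (n + 1) = b * (a * c - b * lU a b n) := by
      rw [lR_succ, pow_succ]; linear_combination a * hc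
    refine ⟨⟨_, h1⟩, ?_⟩
    rw [lU_succ a b (n + 1)]
    refine ⟨a * c - b * lU a b n + a * d, ?_⟩
    push_cast
    rw [pow_succ] at *
    linear_combination h1 + a * hd

lemma lU_mod4 (a b : ℤ) (hab : Odd (a + b)) (k : ℕ) :
    ((lU a b (2 * k + 1) : ℤ) : ZMod 4) = (-1) ^ k ∧
    2 * ((lR a b (2 * k + 1) : ℤ) : ZMod 4) = 2 * (a : ZMod 4) := by
  have hab' : 2 * ((a : ZMod 4) + b) = 2 := by
    obtain ⟨t, ht⟩ := hab
    have : ((a + b : ℤ) : ZMod 4) = ((2 * t + 1 : ℤ) : ZMod 4) := by rw [ht]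
    push_cast at this
    rw [this]
    have h4 : (4 : ZMod 4) = 0 := rfl
    linear_combination (t : ZMod 4) * h4
  induction k with
  | zero => simp [lU_succ, lR_succ, lR_zero, lU_zero]
  | succ k ih =>
    obtain ⟨h1, h2⟩ := ih
    have e := luc_add a b (2 * k + 1) 2
    have e2 : lR a b 2 = a ^ 2 - b ^ 2 ∧ lU a b 2 = 2 * a := by
      simp [lU_succ, lR_succ, lR_zero, lU_zero]; constructor <;> ring
    rw [show 2 * (k + 1) + 1 = 2 * k + 1 + 2 by ring, e.1, e.2, e2.1, e2.2]
    push_cast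
    rw [h1, pow_succ (-1 : ZMod 4) k]
    have h3 : ((-1 : ZMod 4) ^ k = 1) ∨ ((-1 : ZMod 4) ^ k = -1) := neg_one_pow_eq_or _ k
    generalize ((lR a b (2 * k + 1) : ℤ) : ZMod 4) = r at *
    generalize (-1 : ZMod 4) ^ k = u at *
    generalize (a : ZMod 4) = A at *
    generalize (b : ZMod 4) = B at *
    clear e e2 h1
    revert r u A B
    decide

lemma nat_abs_of_sign (u : ℤ) (M : ℕ) (hu : 0 < (-1) ^ M * u) : (u.natAbs : ℤ) = (-1) ^ M * u := by
  rcases neg_one_pow_eq_or ℤ M with h | h <;> rw [h] at hu ⊢ <;> omega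

lemma odd_of_mod4 (u : ℤ) (k : ℕ) (h : (u : ZMod 4) = (-1) ^ k) : Odd u.natAbs := by
  rcases neg_one_pow_eq_or (ZMod 4) k with h' | h' <;> rw [h'] at h
  · have : ((u - 1 : ℤ) : ZMod 4) = 0 := by push_cast; rw [h]; ring
    rw [ZMod.intCast_zmod_eq_zero_iff_dvd] at this
    rw [Nat.odd_iff]; push_cast at this; omega
  · have : ((u + 1 : ℤ) : ZMod 4) = 0 := by push_cast; rw [h]; ring
    rw [ZMod.intCast_zmod_eq_zero_iff_dvd] at this
    rw [Nat.odd_iff]; push_cast at this; omega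

lemma jac_neg_one (u : ℤ) (M k : ℕ) (hu : 0 < (-1) ^ M * u) (h : (u : ZMod 4) = (-1) ^ k) :
    J(-1 | u.natAbs) = (-1) ^ M * (-1) ^ k := by
  rw [jacobiSym.at_neg_one (odd_of_mod4 u k h)]
  have e : ((u.natAbs : ℕ) : ZMod 4) = (-1) ^ M * (-1) ^ k := by
    have := congrArg (Int.cast : ℤ → ZMod 4) (nat_abs_of_sign u M hu)
    push_cast at this
    rw [← h, ← this]
    simp
  rw [e]
  rcases Nat.even_or_odd M with h1 | h1 <;> rcases Nat.even_or_odd k with h2 | h2 <;>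
    simp only [h1.neg_one_pow, h2.neg_one_pow] <;> decide

lemma signed_rec (u w : ℤ) (Mu ku Mw kw : ℕ) (hu : 0 < (-1) ^ Mu * u) (hu4 : (u : ZMod 4) = (-1) ^ ku)
    (hw : 0 < (-1) ^ Mw * w) (hw4 : (w : ZMod 4) = (-1) ^ kw) :
    J(u | w.natAbs) = (-1) ^ (Mu * Mw) * (-1) ^ (ku * kw) * J(w | u.natAbs) := by
  have ju := jac_neg_one u Mu ku hu hu4
  have jw := jac_neg_one w Mw kw hw hw4
  have ou := odd_of_mod4 u ku hu4
  have ow := odd_of_mod4 w kw hw4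
  have eu : (-1 : ℤ) ^ (u.natAbs / 2) = (-1) ^ Mu * (-1) ^ ku := by
    rw [← ju, jacobiSym.at_neg_one ou, ZMod.χ₄_eq_neg_one_pow (Nat.odd_iff.mp ou)]
  have ew : (-1 : ℤ) ^ (w.natAbs / 2) = (-1) ^ Mw * (-1) ^ kw := by
    rw [← jw, jacobiSym.at_neg_one ow, ZMod.χ₄_eq_neg_one_pow (Nat.odd_iff.mp ow)]
  have hmul : ∀ (v : ℤ) (M : ℕ) (t : ℕ), 0 < (-1) ^ M * v → J(v | t) = J(-1 | t) ^ M * J((v.natAbs : ℤ) | t) := by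
    intro v M t hv
    rw [nat_abs_of_sign v M hv, jacobiSym.mul_left, jacobiSym.pow_left, ← mul_assoc, ← jacobiSym.pow_left,
      ← jacobiSym.mul_left, ← mul_pow]
    simp
  have hq := jacobiSym.quadratic_reciprocity ou ow
  rw [pow_mul, eu] at hq
  have hq2 : ((-1 : ℤ) ^ Mu * (-1) ^ ku) ^ (w.natAbs / 2) = (-1) ^ ((Mu + ku) * (Mw + kw)) := by
    rw [← pow_add, ← pow_mul, mul_comm, pow_mul, ew, ← pow_add, ← pow_mul, mul_comm]
  rw [hq2] at hq
  rw [hmul u Mu _ hu, hmul w Mw _ hw, hq, ju, jw]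
  simp only [← pow_add, ← pow_mul, ← mul_assoc]
  congr 1
  apply (neg_one_pow_congr ?_)
  simp only [Nat.even_add, Nat.even_mul]
  tauto

lemma real_sign (a b : ℤ) (hb : 0 < b) (hab : b < a) : ∃ x : ℝ, 0 < x ∧ x < 1 / 4 ∧
    ∀ n : ℕ, lU a b n ≠ 0 → 0 < (-1) ^ ⌊(n : ℝ) * x⌋₊ * lU a b n := by
  have hπ := Real.pi_pos
  have ha : (0 : ℝ) < a := by exact_mod_cast hb.trans hab
  have hb' : (0 : ℝ) < b := by exact_mod_cast hb
  have hab' : (b : ℝ) < a := by exact_mod_cast hab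
  set θ := Real.arctan (b / a) with hθ
  have h0 : 0 < θ := Real.arctan_pos.mpr (by positivity)
  have h1 : θ < Real.pi / 4 := by
    rw [← Real.arctan_one]; exact Real.arctan_strictMono ((div_lt_one ha).mpr hab')
  have hc : 0 < Real.cos θ := Real.cos_pos_of_mem_Ioo ⟨by linarith, by linarith⟩
  set ρ := a / Real.cos θ with hρ
  have hρ0 : 0 < ρ := by positivity
  have e1 : (a : ℝ) = ρ * Real.cos θ := by rw [hρ]; field_simp
  have e2 : (b : ℝ) = ρ * Real.sin θ := by
    have := Real.tan_arctan (b / a : ℝ)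
    rw [← hθ, Real.tan_eq_sin_div_cos] at this
    rw [hρ]; field_simp at this ⊢; linarith
  have key : ∀ n : ℕ, (lR a b n : ℝ) = ρ ^ n * Real.cos (n * θ) ∧
      (b : ℝ) * (lU a b n : ℝ) = ρ ^ n * Real.sin (n * θ) := by
    intro n
    induction n with
    | zero => simp [lR_zero, lU_zero]
    | succ n ih =>
      obtain ⟨i1, i2⟩ := ih
      rw [lR_succ, lU_succ]
      push_cast
      rw [add_mul, one_mul, Real.cos_add, Real.sin_add, pow_succ]
      constructor
      · calc _ = (a : ℝ) * lR a b n - b * (b * lU a b n) := by ring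
          _ = _ := by rw [i1, i2, e1, e2]; ring
      · calc _ = (b : ℝ) * lR a b n + a * (b * lU a b n) := by ring
          _ = _ := by rw [i1, i2, e1, e2]; ring
  refine ⟨θ / Real.pi, by positivity, by rw [div_lt_iff₀ hπ]; linarith, ?_⟩
  intro n hn
  set M := ⌊(n : ℝ) * (θ / Real.pi)⌋₊ with hM
  have hx0 : 0 ≤ (n : ℝ) * (θ / Real.pi) := by positivity
  have f1 : (M : ℝ) ≤ n * (θ / Real.pi) := Nat.floor_le hx0
  have f2 : n * (θ / Real.pi) < (M : ℝ) + 1 := Nat.lt_floor_add_one _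
  have g : (n : ℝ) * θ = n * (θ / Real.pi) * Real.pi := by field_simp
  have hs : 0 ≤ Real.sin (n * θ - M * Real.pi) := by
    apply Real.sin_nonneg_of_nonneg_of_le_pi <;> rw [g] <;> nlinarith
  rw [Real.sin_sub_nat_mul_pi] at hs
  have : (0 : ℝ) ≤ ((-1) ^ M * lU a b n) := by
    have h3 : (b : ℝ) * ((-1) ^ M * lU a b n) = ρ ^ n * ((-1) ^ M * Real.sin (n * θ)) := by
      linear_combination (-1) ^ M * (key n).2
    have h4 : 0 ≤ (b : ℝ) * ((-1) ^ M * lU a b n) := by rw [h3]; positivity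
    exact (mul_nonneg_iff_of_pos_left hb').mp h4
  have h5 : 0 ≤ (-1) ^ M * lU a b n := by exact_mod_cast this
  exact lt_of_le_of_ne h5 (Ne.symm (mul_ne_zero (by simp) hn))

/-- floor sum -/
def latS (n m M : ℕ) : ℕ := ∑ i ∈ Icc 1 M, n * i / m

lemma div_eq_sum_ite (n m i N : ℕ) (hm : 0 < m) (h : n * i / m ≤ N) :
    n * i / m = ∑ j ∈ Icc 1 N, if m * j ≤ n * i then 1 else 0 := by
  rw [← Finset.card_filter]
  have : (Icc 1 N).filter (fun j => m * j ≤ n * i) = Icc 1 (n * i / m) := by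
    ext j
    simp only [mem_filter, mem_Icc]
    rw [Nat.le_div_iff_mul_le hm, mul_comm j m]
    constructor
    · tauto
    · rintro ⟨h1, h2⟩
      refine ⟨⟨h1, ?_⟩, h2⟩
      refine le_trans ?_ h
      rw [Nat.le_div_iff_mul_le hm, mul_comm j m]; exact h2
  rw [this]; simp

lemma div_le_floor (x : ℝ) (n m i : ℕ) (hm : 0 < m) (hx : 0 ≤ x) (hi : i ≤ ⌊(m : ℝ) * x⌋₊) :
    n * i / m ≤ ⌊(n : ℝ) * x⌋₊ := by
  apply Nat.le_floor
  have h1 : (i : ℝ) ≤ m * x := (Nat.le_floor_iff (by positivity)).mp hi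
  have hm' : (0 : ℝ) < m := by exact_mod_cast hm
  calc ((n * i / m : ℕ) : ℝ) ≤ ((n * i : ℕ) : ℝ) / m := Nat.cast_div_le
    _ ≤ n * x := by
      rw [div_le_iff₀ hm']; push_cast
      have : (0 : ℝ) ≤ n := by positivity
      nlinarith

lemma floor_lt (x : ℝ) (m : ℕ) (hm : 0 < m) (hx : 0 ≤ x) (hx1 : x < 1 / 4) :
    4 * ⌊(m : ℝ) * x⌋₊ < m := by
  have h1 : (⌊(m : ℝ) * x⌋₊ : ℝ) ≤ m * x := Nat.floor_le (by positivity)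
  have hm' : (0 : ℝ) < m := by exact_mod_cast hm
  have : (4 : ℝ) * ⌊(m : ℝ) * x⌋₊ < m := by nlinarith
  exact_mod_cast this

lemma not_dvd_of_coprime (n m i : ℕ) (h : Nat.Coprime n m) (hi : 1 ≤ i) (him : i < m) :
    ¬ m ∣ n * i := by
  intro hd
  have := (Nat.Coprime.dvd_mul_left h.symm).mp hd
  exact absurd (Nat.le_of_dvd (by omega) this) (by omega)

lemma lattice (x : ℝ) (hx : 0 ≤ x) (hx1 : x < 1 / 4) (n m : ℕ) (hn : 0 < n) (hm : 0 < m)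
    (h : Nat.Coprime n m) :
    latS n m ⌊(m : ℝ) * x⌋₊ + latS m n ⌊(n : ℝ) * x⌋₊ = ⌊(n : ℝ) * x⌋₊ * ⌊(m : ℝ) * x⌋₊ := by
  have hM := floor_lt x m hm hx hx1
  have d1 := fun i => div_le_floor x n m i hm hx
  have d2 := fun i => div_le_floor x m n i hn hx
  generalize ⌊(m : ℝ) * x⌋₊ = M at *
  generalize ⌊(n : ℝ) * x⌋₊ = N at *
  unfold latS
  rw [Finset.sum_congr rfl (fun i hi => div_eq_sum_ite n m i N hm (d1 i (mem_Icc.mp hi).2)),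
    Finset.sum_congr rfl (fun i hi => div_eq_sum_ite m n i M hn (d2 i (mem_Icc.mp hi).2)),
    Finset.sum_comm, ← Finset.sum_add_distrib]
  have : ∀ j ∈ Icc 1 N, ((∑ i ∈ Icc 1 M, if m * j ≤ n * i then 1 else 0) +
      ∑ i ∈ Icc 1 M, if n * i ≤ m * j then 1 else 0) = M := by
    intro j hj
    rw [← Finset.sum_add_distrib]
    trans ∑ i ∈ Icc 1 M, 1
    · apply Finset.sum_congr rfl
      intro i hi
      rw [mem_Icc] at hi
      have hne : n * i ≠ m * j := fun he =>
        not_dvd_of_coprime n m i h hi.1 (by omega) ⟨j, he⟩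
      rcases lt_or_gt_of_ne hne with hl | hl
      · rw [if_neg (by omega), if_pos (by omega)]
      · rw [if_pos (by omega), if_neg (by omega)]
    · simp
  rw [Finset.sum_congr rfl this]; simp

lemma latS_add (r m M : ℕ) (hm : 0 < m) :
    (-1 : ℤ) ^ latS (r + 2 * m) m M = (-1) ^ latS r m M := by
  have : latS (r + 2 * m) m M = latS r m M + 2 * ∑ i ∈ Icc 1 M, i := by
    unfold latS
    rw [Finset.mul_sum, ← Finset.sum_add_distrib]
    apply Finset.sum_congr rfl
    intro i _
    rw [show (r + 2 * m) * i = r * i + m * (2 * i) by ring, Nat.add_mul_div_left _ _ hm]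
  rw [this, pow_add, pow_mul]; simp

lemma div_add_div_of_not_dvd (u v m t : ℕ) (hm : 0 < m) (h : u + v = m * t) (hu : ¬ m ∣ u) :
    u / m + v / m + 1 = t := by
  have h1 : u % m ≠ 0 := fun h => hu (Nat.dvd_of_mod_eq_zero h)
  have h2 := Nat.div_add_mod u m
  have h3 := Nat.div_add_mod v m
  have h4 := Nat.mod_lt u hm
  have h5 := Nat.mod_lt v hm
  have h6 : u % m + v % m = m := by
    have : m ∣ u % m + v % m := by
      have h7 : m ∣ m * (u / m) + m * (v / m) + (u % m + v % m) := ⟨t, by omega⟩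
      exact (Nat.dvd_add_right (Dvd.intro (u / m + v / m) (by ring))).mp h7
    obtain ⟨c, hc⟩ := this
    have : c = 1 := by
      have c1 : c < 2 := by by_contra hh; push Not at hh; nlinarith
      have c0 : c ≠ 0 := by rintro rfl; omega
      omega
    rw [hc, this, mul_one]
  have : m * (u / m + v / m + 1) = m * t := by rw [← h]; ring_nf; omega
  exact Nat.eq_of_mul_eq_mul_left hm this

lemma latS_refl (n n' m M : ℕ) (hm : 0 < m) (h : n + n' = 2 * m) (hM : M < m)
    (hc : Nat.Coprime n m) :
    (-1 : ℤ) ^ latS n m M = (-1) ^ M * (-1) ^ latS n' m M := by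
  have e : latS n m M + latS n' m M + M = 2 * ∑ i ∈ Icc 1 M, i := by
    unfold latS
    have : M = ∑ i ∈ Icc 1 M, 1 := by simp
    nth_rewrite 3 [this]
    rw [Finset.mul_sum, ← Finset.sum_add_distrib, ← Finset.sum_add_distrib]
    apply Finset.sum_congr rfl
    intro i hi
    rw [mem_Icc] at hi
    exact div_add_div_of_not_dvd _ _ m _ hm (by rw [← add_mul, h]; ring)
      (not_dvd_of_coprime n m i hc hi.1 (by omega))
  rw [← pow_add]
  apply neg_one_pow_congr
  have : Even (latS n m M + latS n' m M + M) := by rw [e]; simp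
  simp only [Nat.even_add] at this ⊢
  tauto

lemma jac_congr (u v : ℤ) (w : ℤ) (h : w ∣ u - v) : J(u | w.natAbs) = J(v | w.natAbs) := by
  apply jacobiSym.mod_left'
  exact (Int.ModEq.symm ((Int.modEq_iff_dvd).mpr (Int.natAbs_dvd.mpr h)))

lemma lU_coprime_Q (a b : ℤ) (hab : Odd (a + b)) (hc : IsCoprime a b) (k : ℕ) :
    J(a ^ 2 + b ^ 2 | (lU a b (2 * k + 1)).natAbs) = 1 := by
  have hQ4 : (a ^ 2 + b ^ 2) % 4 = 1 := by
    rcases Int.even_or_odd a with ⟨s, hs⟩ | ⟨s, hs⟩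
    · have hb : Odd b := by
        have := (Int.odd_add.mp hab); by_contra hh
        have h2 := this.mpr (Int.not_odd_iff_even.mp hh)
        exact (Int.not_odd_iff_even.mpr ⟨s, hs⟩) h2
      obtain ⟨t, ht⟩ := hb
      have : a ^ 2 + b ^ 2 = 4 * (s ^ 2 + t ^ 2 + t) + 1 := by rw [hs, ht]; ring
      omega
    · have hb : Even b := (Int.odd_add.mp hab).mp ⟨s, hs⟩
      obtain ⟨t, ht⟩ := hb
      have : a ^ 2 + b ^ 2 = 4 * (s ^ 2 + t ^ 2 + s) + 1 := by rw [hs, ht]; ring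
      omega
  have hpos : 0 < a ^ 2 + b ^ 2 := by
    rcases lt_or_eq_of_le (show 0 ≤ a ^ 2 + b ^ 2 by positivity) with h | h
    · exact h
    · omega
  obtain ⟨Q, hQ⟩ := Int.eq_ofNat_of_zero_le hpos.le
  have hcop : IsCoprime (2 * a) (a ^ 2 + b ^ 2) := by
    apply IsCoprime.mul_left
    · exact ⟨-2 * ((a ^ 2 + b ^ 2) / 4), 1, by omega⟩
    · have : IsCoprime a (b ^ 2) := hc.pow_right
      have h2 := this.add_mul_left_right a
      rwa [show b ^ 2 + a * a = a ^ 2 + b ^ 2 by ring] at h2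
  have h1 := (lU_modQ a b (2 * k)).1
  have ho := odd_of_mod4 _ k (lU_mod4 a b hab k).1
  rw [hQ] at h1 hcop hQ4 ⊢
  have hQn : Q % 4 = 1 := by omega
  rw [jacobiSym.quadratic_reciprocity_one_mod_four hQn ho]
  have hQo : Odd Q := by rw [Nat.odd_iff]; omega
  have hneg : J(-1 | Q) = 1 := by
    rw [jacobiSym.at_neg_one hQo, ZMod.χ₄_nat_one_mod_four hQn]
  have habs : ∀ u : ℤ, J((u.natAbs : ℤ) | Q) = J(u | Q) := by
    intro u
    rcases Int.natAbs_eq u with h | h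
    · rw [← h]
    · nth_rewrite 2 [h]
      rw [jacobiSym.neg _ hQo, ZMod.χ₄_nat_one_mod_four hQn, one_mul]
  rw [habs]
  have := jac_congr _ _ _ h1
  simp only [Int.natAbs_natCast] at this
  rw [this, jacobiSym.pow_left, pow_mul, jacobiSym.sq_one, one_pow]
  exact Int.isCoprime_iff_gcd_eq_one.mp hcop

lemma key_lemma (a b : ℤ) (hab : Odd (a + b)) (hc : IsCoprime a b) (x : ℝ) (hx : 0 < x)
    (hx1 : x < 1 / 4) (hs : ∀ k : ℕ, 0 < (-1) ^ ⌊((2 * k + 1 : ℕ) : ℝ) * x⌋₊ * lU a b (2 * k + 1)) :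
    ∀ m n : ℕ, Odd m → Odd n → Nat.Coprime n m →
    J(lU a b n | (lU a b m).natAbs) = J(n | m) * (-1) ^ latS n m ⌊(m : ℝ) * x⌋₊ := by
  intro m
  induction m using Nat.strong_induction_on with
  | _ m IHm =>
  intro n
  induction n using Nat.strong_induction_on with
  | _ n IHn =>
  intro hm hn hnm
  have hm0 : 0 < m := hm.pos
  have hn0 : 0 < n := hn.pos
  by_cases m1 : m = 1
  · subst m1
    have : ⌊((1 : ℕ) : ℝ) * x⌋₊ = 0 := by
      have := floor_lt x 1 one_pos hx.le hx1; omega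
    rw [this]
    simp [lU_one, latS]
  obtain ⟨k, hk⟩ := id hm
  obtain ⟨l, hl⟩ := id hn
  have hQ := lU_coprime_Q a b hab hc k
  have hMm := floor_lt x m hm0 hx.le hx1
  rw [← hk] at hQ
  rcases lt_trichotomy n m with hlt | heq | hgt
  · -- reciprocity
    have h1 := IHm n hlt m hn hm hnm.symm
    have h2 := signed_rec (lU a b n) (lU a b m) _ l _ k (by rw [hl]; exact hs l)
      (by rw [hl]; exact (lU_mod4 a b hab l).1) (by rw [hk]; exact hs k)
      (by rw [hk]; exact (lU_mod4 a b hab k).1)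
    rw [← hl, ← hk] at h2
    have h3 := jacobiSym.quadratic_reciprocity hm hn
    rw [h2, h1, h3, ← lattice x hx.le hx1 n m hn0 hm0 hnm]
    have e1 : n / 2 = l := by omega
    have e2 : m / 2 = k := by omega
    rw [e1, e2, pow_add, mul_comm k l]
    have s1 : ∀ t : ℕ, ((-1 : ℤ) ^ t) * (-1) ^ t = 1 := by
      intro t; rw [← mul_pow]; simp
    linear_combination (-1) ^ latS n m ⌊(m : ℝ) * x⌋₊ * J(n | m) *
      ((-1) ^ latS m n ⌊(n : ℝ) * x⌋₊ * (-1) ^ latS m n ⌊(n : ℝ) * x⌋₊ * s1 (l * k)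
        + s1 (latS m n ⌊(n : ℝ) * x⌋₊))
  · rw [heq, Nat.coprime_self] at hnm; omega
  · by_cases h2m : 2 * m < n
    · obtain ⟨r, rfl⟩ := Nat.exists_eq_add_of_lt h2m
      rw [show 2 * m + r + 1 = (r + 1) + 2 * m by ring] at *
      have hro : Odd (r + 1) := by
        rw [Nat.odd_iff] at *; omega
      have hrc : Nat.Coprime (r + 1) m := by
        simpa using hnm
      have h1 := IHn (r + 1) (by omega) hm hro hrc
      have h2 := jac_congr _ _ _ (lU_dvd1 a b (r + 1) m)
      rw [h2, jacobiSym.mul_left, jacobiSym.pow_left, hQ, one_pow, one_mul, h1, latS_add _ _ _ hm0]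
      congr 1
      apply jacobiSym.mod_left'
      push_cast
      simp
    · have hlt2 : n < 2 * m := by
        rw [Nat.odd_iff] at hn; omega
      obtain ⟨n', hn'⟩ := Nat.exists_eq_add_of_lt hlt2
      have hsum : n + (n' + 1) = 2 * m := by omega
      have hro : Odd (n' + 1) := by
        rw [Nat.odd_iff] at *; omega
      have hrc : Nat.Coprime (n' + 1) m := by
        have hg : Nat.gcd (n' + 1) m ∣ n := by
          have : Nat.gcd (n' + 1) m ∣ n + (n' + 1) := by
            rw [hsum]; exact Dvd.dvd.mul_left (Nat.gcd_dvd_right _ _) _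
          exact (Nat.dvd_add_left (Nat.gcd_dvd_left _ _)).mp this
        have h9 := Nat.dvd_gcd hg (Nat.gcd_dvd_right (n' + 1) m)
        rw [hnm] at h9
        exact Nat.dvd_one.mp h9
      have h1 := IHn (n' + 1) (by omega) hm hro hrc
      have h2 := jac_congr _ _ _ (lU_dvd2 a b n (n' + 1) m hsum)
      rw [jacobiSym.mul_left, jacobiSym.mul_left, jacobiSym.mul_left, jacobiSym.pow_left,
        jacobiSym.pow_left, hQ, one_pow, one_pow, one_mul, one_mul, h1] at h2
      have h3 := jac_neg_one (lU a b m) _ k (by rw [hk]; exact hs k)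
        (by rw [hk]; exact (lU_mod4 a b hab k).1)
      rw [← hk] at h3
      rw [h3] at h2
      have h4 : J(n | m) = (-1) ^ k * J((n' + 1 : ℕ) | m) := by
        have : J(n | m) = J(-1 * ((n' + 1 : ℕ) : ℤ) | m) := by
          have := jac_congr (n : ℤ) (-1 * ((n' + 1 : ℕ) : ℤ)) (m : ℤ) ⟨2, by push_cast; omega⟩
          simpa only [Int.natAbs_natCast] using this
        rw [this, jacobiSym.mul_left, jacobiSym.at_neg_one hm, ZMod.χ₄_eq_neg_one_pow (Nat.odd_iff.mp hm)]
        congr 2; omega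
      rw [h4, latS_refl n (n' + 1) m _ hm0 hsum (by omega) hnm]
      have s1 : ∀ t : ℕ, ((-1 : ℤ) ^ t) * (-1) ^ t = 1 := by
        intro t; rw [← mul_pow]; simp
      generalize ⌊(m : ℝ) * x⌋₊ = M at *
      linear_combination (-(-1) ^ M * (-1) ^ k) * h2 -
        J(lU a b n | (lU a b m).natAbs) * ((-1) ^ k * (-1) ^ k * s1 M + s1 k)

lemma latS_range (n m M : ℕ) : latS n m M = ∑ i ∈ range (M + 1), n * i / m := by
  unfold latS
  induction M with
  | zero => simp
  | succ M ih => rw [Finset.sum_Icc_succ_top (by omega), Finset.sum_range_succ, ih]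

lemma div_eq_div_of (R p X Y t : ℕ) (hR : 0 < R) (ht : t < p) (h : R * X = Y * p + t) :
    X / p = Y / R := by
  have hp : 0 < p := by omega
  apply Nat.div_eq_of_lt_le
  · have h1 := Nat.div_mul_le_self Y R
    have : R * (Y / R * p) ≤ R * X := by
      rw [h]; calc R * (Y / R * p) = (Y / R * R) * p := by ring
        _ ≤ Y * p := Nat.mul_le_mul_right _ h1
        _ ≤ _ := Nat.le_add_right _ _
    exact Nat.le_of_mul_le_mul_left this hR
  · have h1 : Y + 1 ≤ (Y / R + 1) * R := by
      have := Nat.lt_div_mul_add hR (a := Y)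
      rw [add_mul]; omega
    have : R * X < R * ((Y / R + 1) * p) := by
      rw [h]; calc Y * p + t < Y * p + p := by omega
        _ = (Y + 1) * p := by ring
        _ ≤ ((Y / R + 1) * R) * p := Nat.mul_le_mul_right _ h1
        _ = _ := by ring
    exact Nat.lt_of_mul_lt_mul_left this

lemma F_formula (R N c : ℕ) (hR : 0 < R) (hc : Nat.Coprime c R) :
    2 * (∑ i ∈ range (R * N + 1), c * i / R) + (∑ i ∈ range (R * N + 1), if R ∣ i then 0 else 1)
      = (R * N + 1) * (c * N) := by
  have h1 := Finset.sum_range_reflect (fun i => c * i / R) (R * N + 1)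
  rw [two_mul]
  nth_rewrite 2 [← h1]
  rw [← Finset.sum_add_distrib, ← Finset.sum_add_distrib]
  trans ∑ i ∈ range (R * N + 1), c * N
  · apply Finset.sum_congr rfl
    intro i hi
    rw [mem_range] at hi
    have he : c * i + c * (R * N + 1 - 1 - i) = R * (c * N) := by
      rw [← mul_add, show i + (R * N + 1 - 1 - i) = R * N by omega]; ring
    by_cases hd : R ∣ i
    · rw [if_pos hd, add_zero, ← Nat.add_div_of_dvd_right (hd.mul_left c), he, Nat.mul_div_cancel_left _ hR]
    · rw [if_neg hd]
      exact div_add_div_of_not_dvd _ _ R _ hR he (fun h => hd ((Nat.Coprime.dvd_mul_left hc.symm).mp h))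
  · simp

lemma F_diff (R N c : ℕ) (hR : 0 < R) (hR2 : Even R) (hN : Odd N) (hcR : Nat.Coprime c R)
    (hc3 : Nat.Coprime (3 * c) R) (hc : Odd c) :
    ∃ s, Odd s ∧ (∑ i ∈ range (R * N + 1), 3 * c * i / R) = (∑ i ∈ range (R * N + 1), c * i / R) + s := by
  have h1 := F_formula R N c hR hcR
  have h2 := F_formula R N (3 * c) hR hc3
  refine ⟨(R * N + 1) * (c * N), ?_, ?_⟩
  · exact ((hR2.mul_right N).add_one).mul (hc.mul hN)
  · have : (R * N + 1) * (3 * c * N) = 3 * ((R * N + 1) * (c * N)) := by ring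
    rw [this] at h2
    omega

lemma combin (p : ℕ) (hp : p.Prime) (hp2 : Odd p) (K : ℕ) (hK : 4 * K < p)
    (H : ∀ n, Odd n → Nat.Coprime n p → J(n | p) = (-1) ^ latS n p K) : False := by
  have : Fact p.Prime := ⟨hp⟩
  rcases Nat.eq_zero_or_pos K with rfl | hK0
  · obtain ⟨t, ht⟩ := FiniteField.exists_nonsquare (F := ZMod p) (by
      rw [ZMod.ringChar_zmod_n]; rintro rfl; revert hp2; decide)
    have : ∃ n : ℕ, Odd n ∧ (n : ZMod p) = t := by
      rcases Nat.even_or_odd t.val with h | h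
      · exact ⟨t.val + p, h.add_odd hp2, by simp⟩
      · exact ⟨t.val, h, by simp⟩
    obtain ⟨n, hn, rfl⟩ := this
    have hcop : Nat.Coprime n p := by
      rw [Nat.coprime_comm, hp.coprime_iff_not_dvd]
      intro hd
      rw [(ZMod.natCast_eq_zero_iff n p).mpr hd] at ht
      exact ht (IsSquare.zero)
    have := H n hn hcop
    simp only [latS, show Icc 1 0 = (∅ : Finset ℕ) from rfl, Finset.sum_empty, pow_zero] at this
    have h2 := ZMod.isSquare_of_jacobiSym_eq_one this
    exact ht (by simpa using h2)
  · obtain ⟨A, hA, hAK⟩ : ∃ A, Even A ∧ (A = K ∨ A = K + 1) := by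
      rcases Nat.even_or_odd K with h | h
      · exact ⟨K, h, Or.inl rfl⟩
      · exact ⟨K + 1, h.add_one, Or.inr rfl⟩
    obtain ⟨k, N, hN, hAe⟩ := Nat.exists_eq_two_pow_mul_odd (n := A) (by omega)
    have hk : k ≠ 0 := by
      rintro rfl
      rw [pow_zero, one_mul] at hAe
      rw [hAe] at hA
      exact (Nat.not_even_iff_odd.mpr hN) hA
    obtain ⟨R, hRdef⟩ : ∃ R, R = 2 ^ k := ⟨_, rfl⟩
    have hR0 : 0 < R := by rw [hRdef]; positivity
    have hRe : Even R := by rw [hRdef]; exact (Nat.even_pow.mpr ⟨even_two, hk⟩)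
    have hcopR : ∀ c, Odd c → Nat.Coprime c R := by
      intro c hc; rw [hRdef]; exact Nat.Coprime.pow_right _ (Nat.coprime_two_right.mpr hc)
    rw [← hRdef] at hAe
    obtain ⟨c', -, hc'⟩ := Nat.exists_mul_mod_eq_one_of_coprime (n := p) (k := 2 * R)
      ((Nat.coprime_mul_iff_right).mpr ⟨Nat.coprime_two_right.mpr hp2, hcopR p hp2⟩) (by omega)
    obtain ⟨c, m, hm, hcm⟩ : ∃ c m, Odd m ∧ R * m = c * p + 1 := by
      refine ⟨c' * (R - 1), 2 * ((p * c' / (2 * R)) * (R - 1)) + 1, ⟨_, rfl⟩, ?_⟩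
      have := Nat.div_add_mod (p * c') (2 * R)
      rw [hc'] at this
      obtain ⟨r, rfl⟩ : ∃ r, R = r + 1 := ⟨R - 1, by omega⟩
      simp only [Nat.add_sub_cancel]
      calc _ = (2 * (r + 1) * (p * c' / (2 * (r + 1))) + 1) * r + 1 := by ring
        _ = _ := by rw [this]; ring
    have hc : Odd c := by
      have h1 : Even (c * p + 1) := by rw [← hcm]; exact hRe.mul_right m
      have h2 : Odd (c * p) := by
        by_contra h; rw [Nat.not_odd_iff_even] at h
        exact (Nat.not_even_iff_odd.mpr h.add_one) h1
      exact (Nat.odd_mul.mp h2).1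
    have hmp : Nat.Coprime m p := by
      rw [Nat.coprime_comm, hp.coprime_iff_not_dvd]
      intro hd
      have h1 : p ∣ c * p + 1 := by rw [← hcm]; exact hd.mul_left R
      have := (Nat.dvd_add_right (Dvd.intro_left c rfl)).mp h1
      exact hp.one_lt.ne' (Nat.dvd_one.mp this)
    have h3p : Nat.Coprime 3 p := by
      rw [Nat.coprime_primes Nat.prime_three hp]; omega
    have j3 := H 3 (by decide) h3p
    have s3 : latS 3 p K = 0 := by
      unfold latS
      apply Finset.sum_eq_zero
      intro i hi; rw [mem_Icc] at hi
      exact Nat.div_eq_of_lt (by omega)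
    rw [s3, pow_zero] at j3
    have jm := H m hm hmp
    have j3m := H (3 * m) (Odd.mul (by decide) hm) (Nat.Coprime.mul_left h3p hmp)
    rw [Nat.cast_mul, jacobiSym.mul_left, j3, one_mul, jm] at j3m
    have e1 : latS m p K = ∑ i ∈ range (K + 1), c * i / R := by
      rw [latS_range]
      apply Finset.sum_congr rfl
      intro i hi; rw [mem_range] at hi
      apply div_eq_div_of R p _ _ i hR0 (by omega)
      rw [← mul_assoc, hcm]; ring
    have e2 : latS (3 * m) p K = ∑ i ∈ range (K + 1), 3 * c * i / R := by
      rw [latS_range]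
      apply Finset.sum_congr rfl
      intro i hi; rw [mem_range] at hi
      apply div_eq_div_of R p _ _ (3 * i) hR0 (by omega)
      calc R * (3 * m * i) = 3 * (R * m) * i := by ring
        _ = _ := by rw [hcm]; ring
    obtain ⟨s, hs, hF⟩ := F_diff R N c hR0 hRe hN (hcopR c hc) (hcopR _ (Odd.mul (by decide) hc)) hc
    have hfin : ∃ s', Odd s' ∧ latS (3 * m) p K + (3 * c * N - c * N) * (A - K) = latS m p K + s' := by
      refine ⟨s, hs, ?_⟩
      rw [← hAe] at hF
      rcases hAK with h | h
      · rw [h] at hF ⊢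
        rw [e1, e2, hF]; simp
      · rw [h, Finset.sum_range_succ, Finset.sum_range_succ (n := K + 1)] at hF
        rw [e1, e2]
        have g1 : 3 * c * (K + 1) / R = 3 * c * N := by
          rw [← h, hAe, show 3 * c * (R * N) = R * (3 * c * N) by ring, Nat.mul_div_cancel_left _ hR0]
        have g2 : c * (K + 1) / R = c * N := by
          rw [← h, hAe, show c * (R * N) = R * (c * N) by ring, Nat.mul_div_cancel_left _ hR0]
        rw [g1, g2] at hF
        rw [h, show K + 1 - K = 1 by omega, mul_one]
        have h7 : 3 * c * N = 3 * (c * N) := by ring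
        omega
    obtain ⟨s', hs', hfin⟩ := hfin
    have h7 : 3 * c * N - c * N = 2 * (c * N) := by
      have h7 : 3 * c * N = 3 * (c * N) := by ring
      omega
    rw [h7, mul_assoc] at hfin
    have := congrArg (fun t => (-1 : ℤ) ^ t) hfin
    simp only [pow_add, pow_mul, hs'.neg_one_pow, ← j3m] at this
    rcases neg_one_pow_eq_or ℤ (latS m p K) with h | h <;> rw [h] at this <;> norm_num at this

lemma core_lemma (p : ℕ) (hp : p.Prime) (hp2 : Odd p) (a b : ℤ) (hb : 0 < b) (hba : b < a)
    (hab : Odd (a + b)) (hc : IsCoprime a b) (v : ℕ) (hv : (lU a b p).natAbs = v ^ 2) : False := by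
  obtain ⟨x, hx, hx1, hs⟩ := real_sign a b hb hba
  have hs' : ∀ k : ℕ, 0 < (-1) ^ ⌊((2 * k + 1 : ℕ) : ℝ) * x⌋₊ * lU a b (2 * k + 1) := by
    intro k
    apply hs
    intro h0
    have := odd_of_mod4 _ k (lU_mod4 a b hab k).1
    rw [h0] at this
    simp at this
  apply combin p hp hp2 _ (floor_lt x p hp.pos hx.le hx1)
  intro n hn hnp
  have h1 := key_lemma a b hab hc x hx hx1 hs' p n hp2 hn hnp
  rw [hv, jacobiSym.pow_right] at h1
  have h2 : J(n | p) = 1 ∨ J(n | p) = -1 := jacobiSym.eq_one_or_neg_one (by simpa using hnp)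
  rcases neg_one_pow_eq_or ℤ (latS n p ⌊(p : ℝ) * x⌋₊) with h | h <;> rw [h] at h1 ⊢ <;>
    rcases h2 with h2 | h2 <;> rw [h2] at h1 ⊢ <;>
    nlinarith [sq_nonneg (J(lU a b n | v))]

lemma luc_neg (a b : ℤ) (n : ℕ) : lU a (-b) n = lU a b n ∧ lR a (-b) n = lR a b n := by
  induction n with
  | zero => simp [lU_zero, lR_zero]
  | succ n ih => rw [lU_succ, lR_succ, lU_succ, lR_succ, ih.1, ih.2]; simp

lemma luc_neg_left (a b : ℤ) (n : ℕ) :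
    lU (-a) b n = -(-1) ^ n * lU a b n ∧ lR (-a) b n = (-1) ^ n * lR a b n := by
  induction n with
  | zero => simp [lU_zero, lR_zero]
  | succ n ih =>
    rw [lU_succ, lR_succ, lU_succ, lR_succ, ih.1, ih.2]
    constructor <;> ring

lemma luc_abs (a b : ℤ) (n : ℕ) : (lU |a| |b| n).natAbs = (lU a b n).natAbs := by
  have h1 : ∀ a, (lU a |b| n) = (lU a b n) := by
    intro a
    rcases abs_choice b with h | h <;> rw [h]
    exact (luc_neg a b n).1
  rw [h1]
  rcases abs_choice a with h | h <;> rw [h]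
  rw [(luc_neg_left a b n).1]
  rcases neg_one_pow_eq_or ℤ n with h | h <;> rw [h] <;> simp

/-- square-ness of the Lucas factor -/
lemma lU_square (p : ℕ) (hp : p.Prime) (a b y : ℤ) (hc : IsCoprime a b) (hpy : ¬ (p : ℤ) ∣ y)
    (h : b * lU a b p = y ^ 2 ∨ b * lU a b p = -y ^ 2) : ∃ v : ℕ, (lU a b p).natAbs = v ^ 2 := by
  obtain ⟨n, rfl⟩ : ∃ n, p = n + 1 := ⟨p - 1, by have := hp.pos; omega⟩
  have hpb : ¬ ((n + 1 : ℕ) : ℤ) ∣ b := by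
    intro hd
    have : ((n + 1 : ℕ) : ℤ) ∣ y ^ 2 := by
      rcases h with h | h
      · rw [← h]; exact hd.mul_right _
      · rw [← dvd_neg, ← h]; exact hd.mul_right _
    exact hpy ((Nat.prime_iff_prime_int.mp hp).dvd_of_dvd_pow this)
  have hpb' : IsCoprime (((n + 1 : ℕ) : ℤ)) b :=
    ((Nat.prime_iff_prime_int.mp hp).coprime_iff_not_dvd).mpr hpb
  obtain ⟨d, hd⟩ := (lU_modb a b n).2
  have hcop : IsCoprime b (lU a b (n + 1)) := by
    have h1 : IsCoprime b (((n + 1 : ℕ) : ℤ) * a ^ n) := (hpb'.mul_left hc.pow_left).symm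
    have h2 := h1.add_mul_left_right d
    have : ((n + 1 : ℕ) : ℤ) * a ^ n + b * d = lU a b (n + 1) := by
      rw [← hd]; push_cast; ring
    rwa [this] at h2
  have hsq : b.natAbs * (lU a b (n + 1)).natAbs = y.natAbs ^ 2 := by
    rw [← Int.natAbs_mul, ← Int.natAbs_pow]
    rcases h with h | h <;> rw [h]
    rw [Int.natAbs_neg]
  have hcn : IsCoprime (lU a b (n + 1)) b := hcop.symm
  have hcn' := Int.isCoprime_iff_gcd_eq_one.mp hcn
  rw [mul_comm] at hsq
  obtain ⟨v, hv⟩ := exists_associated_pow_of_mul_eq_pow (a := (lU a b (n+1)).natAbs) (b := b.natAbs)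
    (by rw [Nat.isUnit_iff]; exact hcn') hsq
  exact ⟨v, (associated_iff_eq.mp hv).symm⟩

lemma gauss_unit_pow (p : ℕ) (hp : Odd p) (u : GaussianIntˣ) : ∃ w : GaussianInt, (u : GaussianInt) = w ^ p := by
  obtain ⟨k, rfl⟩ := hp
  obtain ⟨u, u', h1, h2⟩ := u
  simp only
  have hn : u ^ 4 = 1 := by
    have hnorm : Zsqrtd.norm u * Zsqrtd.norm u' = 1 := by rw [← Zsqrtd.norm_mul, h1]; simp
    have h0 : 0 ≤ Zsqrtd.norm u := Zsqrtd.norm_nonneg (by norm_num) u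
    have h3 : Zsqrtd.norm u = 1 := by
      rcases Int.eq_one_or_neg_one_of_mul_eq_one hnorm with h | h <;> omega
    obtain ⟨s, t⟩ := u
    simp only [Zsqrtd.norm_def] at h3
    have hs : s ^ 2 ≤ 1 := by nlinarith [sq_nonneg t]
    have ht : t ^ 2 ≤ 1 := by nlinarith [sq_nonneg s]
    have hs1 : -1 ≤ s ∧ s ≤ 1 := ⟨by nlinarith, by nlinarith⟩
    have ht1 : -1 ≤ t ∧ t ≤ 1 := ⟨by nlinarith, by nlinarith⟩
    obtain ⟨s0, s1⟩ := hs1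
    obtain ⟨t0, t1⟩ := ht1
    interval_cases s <;> interval_cases t <;> first | (exfalso; revert h3; norm_num; done) | rfl
  refine ⟨u ^ (2 * k + 1), ?_⟩
  rw [← pow_mul]
  have : (2 * k + 1) * (2 * k + 1) = 4 * (k ^ 2 + k) + 1 := by ring
  rw [this, pow_succ, pow_mul, hn]; simp

lemma gauss_coprime (x y t : ℤ) (hxy : IsCoprime x y) (hz : x ^ 4 + y ^ 4 = 2 * t + 1) :
    IsCoprime (⟨x ^ 2, y ^ 2⟩ : GaussianInt) ⟨x ^ 2, -y ^ 2⟩ := by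
  obtain ⟨u, v, h⟩ : IsCoprime (x ^ 2) (y ^ 2) := hxy.pow
  set A : GaussianInt := ⟨x ^ 2, y ^ 2⟩ with hA
  set B : GaussianInt := ⟨x ^ 2, -y ^ 2⟩ with hB
  have e1 : (u : GaussianInt) * (A + B) + v * ⟨0, -1⟩ * (A - B) = 2 := by
    ext
    · simp [hA, hB]; linear_combination 2 * h
    · simp [hA, hB]
  have e2 : A * B = 2 * (t : GaussianInt) + 1 := by
    ext
    · simp [hA, hB]; linear_combination hz
    · simp [hA, hB]; ring
  exact ⟨B - t * (u + v * ⟨0, -1⟩), -t * (u - v * ⟨0, -1⟩), by linear_combination e2 - t * e1⟩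

lemma luc_swap (a b : ℤ) (k : ℕ) :
    lR b a (2 * k + 1) = (-1) ^ k * (b * lU a b (2 * k + 1)) ∧
    a * lU b a (2 * k + 1) = (-1) ^ k * lR a b (2 * k + 1) := by
  induction k with
  | zero => simp [lU_succ, lR_succ, lR_zero, lU_zero]
  | succ k ih =>
    have e2 : ∀ a b : ℤ, lR a b 2 = a ^ 2 - b ^ 2 ∧ lU a b 2 = 2 * a := by
      intro a b
      simp [lU_succ, lR_succ, lR_zero, lU_zero]; constructor <;> ring
    have f1 := luc_add a b (2 * k + 1) 2
    have f2 := luc_add b a (2 * k + 1) 2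
    rw [(e2 a b).1, (e2 a b).2] at f1
    rw [(e2 b a).1, (e2 b a).2] at f2
    rw [show 2 * (k + 1) + 1 = 2 * k + 1 + 2 by ring, f1.1, f1.2, f2.1, f2.2, pow_succ (-1 : ℤ) k]
    obtain ⟨i1, i2⟩ := ih
    constructor
    · linear_combination (b ^ 2 - a ^ 2) * i1 - 2 * a * b * i2
    · linear_combination (b ^ 2 - a ^ 2) * i2 + 2 * a * b * i1

lemma reduce_core (p : ℕ) (hp : p.Prime) (hp2 : Odd p) (a b x y : ℤ) (ha : a ≠ 0) (hb : b ≠ 0)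
    (hab : Odd (a + b)) (hc : IsCoprime a b) (hx : ¬ (p : ℤ) ∣ x) (hy : ¬ (p : ℤ) ∣ y)
    (h1 : lR a b p = x ^ 2) (h2 : b * lU a b p = y ^ 2) : False := by
  obtain ⟨v, hv⟩ := lU_square p hp a b y hc hy (Or.inl h2)
  have h3 : a * lU b a p = x ^ 2 ∨ a * lU b a p = -x ^ 2 := by
    obtain ⟨k, hk⟩ := hp2
    have := (luc_swap a b k).2
    rw [← hk, h1] at this
    rcases neg_one_pow_eq_or ℤ k with h | h <;> rw [h] at this <;> rw [this]
    · left; ring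
    · right; ring
  obtain ⟨w, hw⟩ := lU_square p hp b a x hc.symm hx h3
  rw [← luc_abs] at hv hw
  have hca : IsCoprime |a| |b| := by
    rw [Int.isCoprime_iff_gcd_eq_one] at hc ⊢
    rw [Int.gcd_def] at hc ⊢; rwa [Int.natAbs_abs, Int.natAbs_abs]
  have hodd : Odd (|a| + |b|) := by
    rw [Int.odd_add] at hab ⊢
    rwa [odd_abs, even_abs]
  rcases lt_trichotomy |a| |b| with h | h | h
  · exact core_lemma p hp hp2 |b| |a| (abs_pos.mpr ha) h (by rwa [add_comm]) hca.symm w hw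
  · rw [h] at hodd; exact (Int.not_odd_iff_even.mpr (Even.add_self _)) hodd
  · exact core_lemma p hp hp2 |a| |b| (abs_pos.mpr hb) h hodd hca v hv

lemma mod4_sum (x y : ℤ) (hx : Odd x) (hy : Odd y) : (x ^ 4 + y ^ 4) % 4 = 2 := by
  obtain ⟨s, rfl⟩ := hx
  obtain ⟨t, rfl⟩ := hy
  ring_nf; omega

theorem fermat_quartic_first_case (p : ℕ) (hp : p.Prime) (hp7 : p ≠ 7) :
    ∀ x y z : ℤ, Int.gcd x y = 1 → x ^ 4 + y ^ 4 = z ^ p → (p : ℤ) ∣ x * y := by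
  intro x y z hg hz
  by_contra hpd
  have hpx : ¬ (p : ℤ) ∣ x := fun h => hpd (h.mul_right y)
  have hpy : ¬ (p : ℤ) ∣ y := fun h => hpd (h.mul_left x)
  have hxy : IsCoprime x y := Int.isCoprime_iff_gcd_eq_one.mpr hg
  have hbad : ¬ (Odd x ∧ Odd y) := by
    rintro ⟨ox, oy⟩
    have h4 := mod4_sum x y ox oy
    have hez : Even z := by
      have : Even (z ^ p) := by rw [← hz, Int.even_iff]; omega
      exact (Int.even_pow.mp this).1
    have : (4 : ℤ) ∣ z ^ p := by
      have h2 : (2 : ℤ) ^ 2 ∣ z ^ p :=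
        (pow_dvd_pow 2 hp.two_le).trans (pow_dvd_pow_of_dvd hez.two_dvd p)
      simpa using h2
    rw [← hz] at this; omega
  rcases hp.eq_two_or_odd' with rfl | hp2
  · apply hbad
    constructor
    · rw [← Int.not_even_iff_odd, even_iff_two_dvd]; exact hpx
    · rw [← Int.not_even_iff_odd, even_iff_two_dvd]; exact hpy
  have hzo : Odd (x ^ 4 + y ^ 4) := by
    rcases Int.even_or_odd x with ex | ox
    · have oy : Odd y := by
        rw [← Int.not_even_iff_odd]
        intro ey
        have := hxy.isUnit_of_dvd' ex.two_dvd ey.two_dvd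
        revert this; rw [Int.isUnit_iff]; norm_num
      exact (ex.pow_of_ne_zero (by norm_num)).add_odd oy.pow
    · have ey : Even y := by
        rw [← Int.not_odd_iff_even]; exact fun h => hbad ⟨ox, h⟩
      exact ox.pow.add_even (ey.pow_of_ne_zero (by norm_num))
  obtain ⟨t, ht⟩ := id hzo
  have hcop := gauss_coprime x y t hxy ht
  have hAB : (⟨x ^ 2, y ^ 2⟩ : GaussianInt) * ⟨x ^ 2, -y ^ 2⟩ = (z : GaussianInt) ^ p := by
    rw [← Int.cast_pow, ← hz]
    ext
    · rw [Zsqrtd.re_intCast]; simp; ring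
    · rw [Zsqrtd.im_intCast]; simp; ring
  obtain ⟨d, u, hd⟩ := exists_associated_pow_of_mul_eq_pow' hcop hAB
  obtain ⟨w, hw⟩ := gauss_unit_pow p hp2 u
  rw [hw, ← mul_pow] at hd
  obtain ⟨⟨a, b⟩, hα⟩ : ∃ α : GaussianInt, α = d * w := ⟨_, rfl⟩
  rw [← hα, luc_gauss, Zsqrtd.ext_iff] at hd
  obtain ⟨h1, h2⟩ := hd
  simp only at h1 h2
  have hx0 : x ≠ 0 := by rintro rfl; exact hpx (dvd_zero _)
  have hy0 : y ≠ 0 := by rintro rfl; exact hpy (dvd_zero _)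
  have hb : b ≠ 0 := by
    rintro rfl
    rw [zero_mul] at h2
    exact hy0 (pow_eq_zero_iff (by norm_num) |>.mp h2.symm)
  have ha : a ≠ 0 := by
    rintro rfl
    obtain ⟨k, hk⟩ := hp2
    have := (luc_swap 0 b k).2
    rw [← hk, h1, zero_mul] at this
    have h5 : x ^ 2 = 0 := by
      rcases mul_eq_zero.mp this.symm with h | h
      · exact absurd h (by simp)
      · exact h
    exact hx0 (pow_eq_zero_iff (by norm_num) |>.mp h5)
  have hab : Odd (a + b) := by
    have hn := luc_norm a b p
    have : Odd ((a ^ 2 + b ^ 2) ^ p) := by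
      rw [← hn, h1, ← mul_pow, h2]
      convert hzo using 1; ring
    have h5 := (Int.odd_pow.mp this).resolve_right hp.pos.ne'
    simpa [Int.odd_add, Int.odd_pow, Int.even_pow] using h5
  have hc : IsCoprime a b := by
    have h5 : IsCoprime (lR a b p) (b * lU a b p) := by rw [h1, h2]; exact hxy.pow
    have h6 := h5.of_mul_right_left
    obtain ⟨n, rfl⟩ : ∃ n, p = n + 1 := ⟨p - 1, by have := hp.pos; omega⟩
    rw [lR_succ] at h6
    have h7 := h6.add_mul_left_left (b * lU a b n)
    rw [show a * lR a b n - b ^ 2 * lU a b n + b * (b * lU a b n) = a * lR a b n by ring] at h7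
    exact h7.of_mul_left_left
  exact reduce_core p hp hp2 a b x y ha hb hab hc hpx hpy h1 h2
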